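/- arXiv:1509.04451 — 3 statements merged into one kernel-verified Lean document; each statement's English description precedes it below -/
import Mathlib

section
/- (Momentum conservation on trees.) Let G be a simple graph on a finite nonempty vertex set V that is a tree (connected and acyclic), let A be an additive commutative group, and let q : V → A. Then there exists a function f : V × V → A satisfying (i) f(u,v) = −f(v,u) for all u,v, (ii) f(u,v) = 0 whenever u and v are not adjacent in G, and (iii) Σ_{u adjacent to v} f(v,u) = q(v) for every vertex v, if and only if Σ_{v∈V} q(v) = 0; moreover, when it exists, such f is unique. -/
namespace SimpleGraph

variable {V A : Type*} [AddCommGroup A] {G : SimpleGraph V}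

/-- An antisymmetric function on ordered pairs of vertices that is supported on the edges
of `G`. -/
structure IsEdgeFlow (G : SimpleGraph V) (f : V → V → A) : Prop where
  antisymm : ∀ u v, f u v = -f v u
  eq_zero_of_not_adj : ∀ u v, ¬ G.Adj u v → f u v = 0

namespace IsEdgeFlow

variable {f g : V → V → A}

lemma zero : G.IsEdgeFlow (fun _ _ => (0 : A)) := ⟨by simp, by simp⟩

lemma add (hf : G.IsEdgeFlow f) (hg : G.IsEdgeFlow g) :
    G.IsEdgeFlow (fun u v => f u v + g u v) where
  antisymm u v := by rw [hf.antisymm, hg.antisymm, neg_add]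
  eq_zero_of_not_adj u v h := by
    rw [hf.eq_zero_of_not_adj u v h, hg.eq_zero_of_not_adj u v h, add_zero]

lemma sub (hf : G.IsEdgeFlow f) (hg : G.IsEdgeFlow g) :
    G.IsEdgeFlow (fun u v => f u v - g u v) where
  antisymm u v := by rw [hf.antisymm, hg.antisymm]; abel
  eq_zero_of_not_adj u v h := by
    rw [hf.eq_zero_of_not_adj u v h, hg.eq_zero_of_not_adj u v h, sub_zero]

lemma sum {ι : Type*} {s : Finset ι} {F : ι → V → V → A} (hF : ∀ i ∈ s, G.IsEdgeFlow (F i)) :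
    G.IsEdgeFlow (fun u v => ∑ i ∈ s, F i u v) where
  antisymm u v := by
    rw [← Finset.sum_neg_distrib]
    exact Finset.sum_congr rfl fun i hi => (hF i hi).antisymm u v
  eq_zero_of_not_adj u v h :=
    Finset.sum_eq_zero fun i hi => (hF i hi).eq_zero_of_not_adj u v h

lemma single [DecidableEq V] {u v : V} (h : G.Adj u v) (a : A) :
    G.IsEdgeFlow (fun x y =>
      (if x = u ∧ y = v then a else 0) - (if x = v ∧ y = u then a else 0)) where
  antisymm x y := by simp only [and_comm, neg_sub]
  eq_zero_of_not_adj x y hxy := by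
    have h₁ : ¬ (x = u ∧ y = v) := by rintro ⟨rfl, rfl⟩; exact hxy h
    have h₂ : ¬ (x = v ∧ y = u) := by rintro ⟨rfl, rfl⟩; exact hxy h.symm
    rw [if_neg h₁, if_neg h₂, sub_zero]

/-- The flows inside a set of vertices cancel. -/
lemma sum_sum_eq_zero (hf : G.IsEdgeFlow f) (s : Finset V) : ∑ x ∈ s, ∑ y ∈ s, f x y = 0 := by
  rw [← Finset.sum_product']
  refine Finset.sum_involution (fun p _ => p.swap) ?_ ?_ ?_ ?_
  · intro p _
    rw [hf.antisymm]
    exact neg_add_cancel _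
  · rintro ⟨x, y⟩ _ hne heq
    obtain rfl : y = x := congrArg Prod.fst heq
    exact hne (hf.eq_zero_of_not_adj y y (G.irrefl))
  · intro p hp
    simpa [and_comm] using hp
  · intro p _
    exact p.swap_swap

variable [Fintype V]

lemma sum_neighborFinset [DecidableRel G.Adj] (hf : G.IsEdgeFlow f) (v : V) :
    ∑ u ∈ G.neighborFinset v, f v u = ∑ u, f v u :=
  Finset.sum_subset (Finset.subset_univ _) fun u _ hu =>
    hf.eq_zero_of_not_adj v u (by simpa using hu)

/-- A flow with zero net outflow everywhere vanishes on bridges. -/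
lemma eq_zero_of_isBridge (hf : G.IsEdgeFlow f) (hdiv : ∀ v, ∑ u, f v u = 0) {u v : V}
    (h : G.IsBridge s(u, v)) : f u v = 0 := by
  classical
  rw [isBridge_iff] at h
  let s : Finset V := {x | (G.deleteEdges {s(u, v)}).Reachable u x}
  have hu : u ∈ s := by simp [s]
  have hv : v ∉ s := by simpa [s] using h
  have hcross : ∀ x ∈ s, ∀ y ∈ sᶜ, ¬ (x = u ∧ y = v) → f x y = 0 := by
    intro x hx y hy hne
    refine hf.eq_zero_of_not_adj x y fun hadj => ?_
    have hx' : (G.deleteEdges {s(u, v)}).Reachable u x := by simpa [s] using hx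
    have hy' : ¬ (G.deleteEdges {s(u, v)}).Reachable u y := by simpa [s] using hy
    refine hy' (hx'.trans (Adj.reachable ?_))
    rw [deleteEdges_adj]
    refine ⟨hadj, fun hmem => ?_⟩
    rcases Sym2.eq_iff.mp hmem with hxy | ⟨rfl, rfl⟩
    · exact hne hxy
    · exact hv hx
  have hzero : ∑ x ∈ s, ∑ y, f x y = 0 := Finset.sum_eq_zero fun x _ => hdiv x
  simp_rw [← Finset.sum_add_sum_compl s] at hzero
  rw [Finset.sum_add_distrib, hf.sum_sum_eq_zero s, zero_add,
    Finset.sum_eq_single_of_mem u hu fun x hx hxu =>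
      Finset.sum_eq_zero fun y hy => hcross x hx y hy fun e => hxu e.1,
    Finset.sum_eq_single_of_mem v (Finset.mem_compl.mpr hv) fun y hy hyv =>
      hcross u hu y hy fun e => hyv e.2] at hzero
  exact hzero

lemma eq_of_isAcyclic (hG : G.IsAcyclic) (hf : G.IsEdgeFlow f) (hg : G.IsEdgeFlow g)
    (hdiv : ∀ v, ∑ u, f v u = ∑ u, g v u) : f = g := by
  funext u v
  by_cases h : G.Adj u v
  · refine sub_eq_zero.mp ((hf.sub hg).eq_zero_of_isBridge (fun x => ?_)
      (isAcyclic_iff_forall_adj_isBridge.mp hG h))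
    rw [Finset.sum_sub_distrib, hdiv, sub_self]
  · rw [hf.eq_zero_of_not_adj u v h, hg.eq_zero_of_not_adj u v h]

end IsEdgeFlow

variable [Fintype V]

lemma Reachable.exists_isEdgeFlow [DecidableEq V] {u v : V} (h : G.Reachable u v) (a : A) :
    ∃ f : V → V → A, G.IsEdgeFlow f ∧
      ∀ x, ∑ y, f x y = (if x = u then a else 0) - (if x = v then a else 0) := by
  obtain ⟨p⟩ := h
  induction p with
  | nil => exact ⟨_, .zero, by simp⟩
  | cons hadj _ ih =>
    obtain ⟨f, hf, hdiv⟩ := ih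
    refine ⟨_, (IsEdgeFlow.single hadj a).add hf, fun x => ?_⟩
    rw [Finset.sum_add_distrib, hdiv, Finset.sum_sub_distrib]
    simp [ite_and]

lemma Connected.exists_isEdgeFlow (hG : G.Connected) {q : V → A} (hq : ∑ v, q v = 0) :
    ∃ f : V → V → A, G.IsEdgeFlow f ∧ ∀ v, ∑ u, f v u = q v := by
  classical
  obtain ⟨r⟩ := hG.nonempty
  choose F hF hdiv using fun v => (hG.preconnected v r).exists_isEdgeFlow (q v)
  refine ⟨_, .sum (s := Finset.univ) fun v _ => hF v, fun x => ?_⟩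
  rw [Finset.sum_comm]
  simp_rw [hdiv, Finset.sum_sub_distrib]
  by_cases hx : x = r <;> simp [hx, hq]

end SimpleGraph


/-- **Momentum conservation on trees.** Let `G` be a tree on a finite nonempty vertex set `V`,
`A` an additive commutative group and `q : V → A`. There is an antisymmetric flow `f` on the
edges of `G` with net outflow `q(v)` at each vertex `v` if and only if `∑ v, q v = 0`;
moreover such a flow is unique when it exists. -/
theorem stmt_14 {V : Type*} [Fintype V] [Nonempty V]
    (G : SimpleGraph V) [DecidableRel G.Adj] (hT : G.IsTree)
    {A : Type*} [AddCommGroup A] (q : V → A) :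
    ((∃ f : V → V → A,
        (∀ u v, f u v = -f v u) ∧
        (∀ u v, ¬ G.Adj u v → f u v = 0) ∧
        (∀ v, ∑ u ∈ G.neighborFinset v, f v u = q v)) ↔ ∑ v, q v = 0) ∧
      (∀ f g : V → V → A,
        ((∀ u v, f u v = -f v u) ∧ (∀ u v, ¬ G.Adj u v → f u v = 0) ∧
          (∀ v, ∑ u ∈ G.neighborFinset v, f v u = q v)) →
        ((∀ u v, g u v = -g v u) ∧ (∀ u v, ¬ G.Adj u v → g u v = 0) ∧
          (∀ v, ∑ u ∈ G.neighborFinset v, g v u = q v)) →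
        f = g) := by
  constructor
  · constructor
    · rintro ⟨f, hanti, hsupp, hdiv⟩
      have hf : G.IsEdgeFlow f := ⟨hanti, hsupp⟩
      simp_rw [← hdiv, hf.sum_neighborFinset]
      exact hf.sum_sum_eq_zero Finset.univ
    · intro hq
      obtain ⟨f, hf, hdiv⟩ := hT.connected.exists_isEdgeFlow hq
      exact ⟨f, hf.antisymm, hf.eq_zero_of_not_adj,
        fun v => (hf.sum_neighborFinset v).trans (hdiv v)⟩
  · rintro f g ⟨hf₁, hf₂, hf₃⟩ ⟨hg₁, hg₂, hg₃⟩
    have hf : G.IsEdgeFlow f := ⟨hf₁, hf₂⟩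
    have hg : G.IsEdgeFlow g := ⟨hg₁, hg₂⟩
    refine hf.eq_of_isAcyclic hT.isAcyclic hg fun v => ?_
    rw [← hf.sum_neighborFinset, ← hg.sum_neighborFinset, hf₃, hg₃]
end

section
/- Let G be a simple graph on the vertex set {1,…,m} that is a tree, and let s assign to each edge of G a real number in [0,1]. Define the real symmetric m×m matrix M by M(l,l) = 1 for every vertex l, and for l ≠ l', M(l,l') = min of s(ℓ) over the edges ℓ lying on the unique path in G from l to l'. Then M is positive semidefinite. -/
open scoped Classical in
/-- The indicator matrix of a symmetric and transitive relation is positive semidefinite. -/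
theorem Matrix.posSemidef_indicator_of_symm_trans {n : Type*} [Fintype n] (r : n → n → Prop)
    (hsymm : ∀ i j, r i j → r j i) (htrans : ∀ i j k, r i j → r j k → r i k) :
    (Matrix.of fun i j => if r i j then (1 : ℝ) else 0).PosSemidef := by
  let B : Matrix (Set n) n ℝ :=
    Matrix.of fun c i => if {k | r i k} = c then (if r i i then (1 : ℝ) else 0) else 0
  have hB : (Matrix.of fun i j => if r i j then (1 : ℝ) else 0) = B.conjTranspose * B := by
    ext i j
    have hiff : r i j ↔ r i i ∧ r j j ∧ {k | r j k} = {k | r i k} := by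
      constructor
      · intro h
        refine ⟨htrans _ _ _ h (hsymm _ _ h), htrans _ _ _ (hsymm _ _ h) h, ?_⟩
        ext k
        exact ⟨fun hk => htrans _ _ _ h hk, fun hk => htrans _ _ _ (hsymm _ _ h) hk⟩
      · rintro ⟨_, hj, he⟩
        exact (Set.ext_iff.mp he j).mp hj
    simp only [Matrix.mul_apply, Matrix.conjTranspose_apply, Matrix.of_apply, B, star_trivial,
      ite_mul, zero_mul, Finset.sum_ite_eq, Finset.mem_univ, if_true]
    rw [if_congr hiff rfl rfl]
    split_ifs <;> simp_all
  rw [hB]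
  exact Matrix.posSemidef_conjTranspose_mul_self B

/-- A symmetric nonnegative real matrix satisfying the ultrametric inequality
`min (M i k) (M k j) ≤ M i j` is positive semidefinite. -/
theorem Matrix.posSemidef_of_ultrametric {n : Type*} [Fintype n] (M : Matrix n n ℝ)
    (hsymm : ∀ i j, M i j = M j i) (hnonneg : ∀ i j, 0 ≤ M i j)
    (hultra : ∀ i j k, min (M i k) (M k j) ≤ M i j) : M.PosSemidef := by
  classical
  induction h : (Finset.univ.filter fun x : n × n => 0 < M x.1 x.2).card
    using Nat.strong_induction_on generalizing M with
  | _ N ih =>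
    subst h
    set S := Finset.univ.filter fun x : n × n => 0 < M x.1 x.2 with hS
    rcases S.eq_empty_or_nonempty with hempty | hne
    · have hM : M = 0 := by
        ext i j
        refine le_antisymm (not_lt.mp fun hpos => ?_) (hnonneg i j)
        have : (i, j) ∈ S := by simpa [hS] using hpos
        simp [hempty] at this
      rw [hM]
      exact Matrix.PosSemidef.zero
    · obtain ⟨⟨a, b⟩, hab, hmin⟩ := S.exists_min_image (fun x => M x.1 x.2) hne
      have hc : 0 < M a b := by simpa [hS] using hab
      replace hmin : ∀ i j, 0 < M i j → M a b ≤ M i j := fun i j hij =>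
        hmin (i, j) (by simp [hS, hij])
      set c := M a b with hcdef
      let E : Matrix n n ℝ := Matrix.of fun i j => if 0 < M i j then (1 : ℝ) else 0
      have hE : E.PosSemidef := Matrix.posSemidef_indicator_of_symm_trans (fun i j => 0 < M i j)
        (fun i j hij => hsymm i j ▸ hij)
        (fun i j k hij hjk => (lt_min hij hjk).trans_le (hultra i k j))
      have happ : ∀ i j, (M - c • E) i j = if 0 < M i j then M i j - c else 0 := by
        intro i j
        have := hnonneg i j
        simp only [Matrix.sub_apply, Matrix.smul_apply, Matrix.of_apply, smul_eq_mul, E]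
        split_ifs <;> linarith
      have hsub : (M - c • E).PosSemidef := by
        refine ih _ (Finset.card_lt_card ?_) (M - c • E) ?_ ?_ ?_ rfl
        · refine Finset.ssubset_iff_subset_ne.mpr ⟨fun x hx => ?_, fun heq => ?_⟩
          · simp only [Finset.mem_filter, Finset.mem_univ, true_and, happ, hS] at hx ⊢
            by_contra hcon
            simp [hcon] at hx
          · rw [← heq] at hab
            simp [happ, ← hcdef] at hab
        · intro i j
          simp only [happ, hsymm i j]
        · intro i j
          rw [happ]
          split_ifs with hij
          · linarith [hmin i j hij]
          · exact le_rfl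
        · intro i j k
          have h₁ := hultra i j k
          have h₂ := hmin i j
          simp only [happ]
          grind
      have hadd := hsub.add (hE.smul hc.le)
      rwa [sub_add_cancel] at hadd

theorem List.le_foldr_min_iff {α : Type*} [LinearOrder α] (L : List α) (a c : α) :
    c ≤ L.foldr min a ↔ c ≤ a ∧ ∀ x ∈ L, c ≤ x := by
  induction L with
  | nil => simp
  | cons x L ih => simp [ih]; tauto

/-- **Positive semidefiniteness of the BKAR interpolating matrix.** Let `G` be a tree on
`{1,…,m}` and let `s` assign to each edge a number in `[0,1]`. The symmetric matrix `M` with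
`M(l,l) = 1` and, for `l ≠ l'`, `M(l,l') = min` of `s` over the edges of the unique path
from `l` to `l'`, is positive semidefinite. -/
theorem stmt_15 (m : ℕ) (G : SimpleGraph (Fin m)) (hT : G.IsTree)
    (s : Sym2 (Fin m) → ℝ) (hs : ∀ e ∈ G.edgeSet, s e ∈ Set.Icc (0 : ℝ) 1)
    (M : Matrix (Fin m) (Fin m) ℝ)
    (hMdiag : ∀ l, M l l = 1)
    (hMoff : ∀ l l', l ≠ l' → ∀ p : G.Walk l l', p.IsPath →
      M l l' = (p.edges.map s).foldr min 1) :
    M.PosSemidef := by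
  have hM : ∀ l l', ∀ p : G.Walk l l', p.IsPath → M l l' = (p.edges.map s).foldr min 1 := by
    intro l l' p hp
    rcases eq_or_ne l l' with rfl | hne
    · rw [(SimpleGraph.Walk.isPath_iff_nil.mp hp).eq_nil, hMdiag]
      simp
    · exact hMoff l l' hne p hp
  have hpath : ∀ l l', ∃ p : G.Walk l l', p.IsPath := fun l l' =>
    (hT.existsUnique_path l l').exists
  have hle : ∀ l l' (p : G.Walk l l'), p.IsPath → ∀ c : ℝ,
      c ≤ M l l' ↔ c ≤ 1 ∧ ∀ e ∈ p.edges, c ≤ s e := by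
    intro l l' p hp c
    simp [hM l l' p hp, List.le_foldr_min_iff]
  apply Matrix.posSemidef_of_ultrametric
  · have hsymm : ∀ i j, M i j ≤ M j i := by
      intro i j
      obtain ⟨p, hp⟩ := hpath i j
      rw [hle j i p.reverse hp.reverse]
      simpa using (hle i j p hp _).mp le_rfl
    exact fun i j => le_antisymm (hsymm i j) (hsymm j i)
  · intro i j
    obtain ⟨p, hp⟩ := hpath i j
    exact (hle i j p hp 0).mpr
      ⟨zero_le_one, fun e he => (hs e (p.edges_subset_edgeSet he)).1⟩
  · intro i j k
    obtain ⟨p, hp⟩ := hpath i k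
    obtain ⟨q, hq⟩ := hpath k j
    have hp' := (hle i k p hp _).mp (min_le_left (M i k) (M k j))
    have hq' := (hle k j q hq _).mp (min_le_right (M i k) (M k j))
    refine (hle i j (p.append q).bypass (p.append q).bypass_isPath _).mpr ⟨hp'.1, fun e he => ?_⟩
    have := (p.append q).edges_bypass_subset_edges he
    rw [SimpleGraph.Walk.edges_append, List.mem_append] at this
    exact this.elim (hp'.2 e) (hq'.2 e)
end

section
/- For every m ≥ 1, the sum over all trees T on the labeled vertex set {1,…,m} (i.e. all connected acyclic simple graphs on {1,…,m}) of the product over vertices l of the factorial of the degree of l in T satisfies: Σ_{T tree on {1,…,m}} ∏_{l=1}^m (d^T(l))! ≤ m! · 8^m. -/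
open scoped Classical

namespace SimpleGraph

universe u

/-- The labeled trees on `V` with prescribed vertex degrees `d`. -/
noncomputable def treesWithDegrees (V : Type u) [Fintype V] (d : V → ℕ) :
    Finset (SimpleGraph V) :=
  {G | G.IsTree ∧ ∀ v, G.degree v = d v}

variable {V : Type u} [Fintype V]

lemma mem_treesWithDegrees {d : V → ℕ} {G : SimpleGraph V} :
    G ∈ treesWithDegrees V d ↔ G.IsTree ∧ ∀ v, G.degree v = d v := by
  simp [treesWithDegrees]

lemma IsTree.sum_degree_add_two {G : SimpleGraph V} (hG : G.IsTree) :
    ∑ v, G.degree v + 2 = 2 * Fintype.card V := by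
  rw [G.sum_degrees_eq_twice_card_edges, ← hG.card_edgeFinset]
  ring

lemma IsTree.eq_top_of_card_eq_two {G : SimpleGraph V} (hG : G.IsTree)
    (hV : Fintype.card V = 2) : G = ⊤ := by
  have : Nontrivial V := Fintype.one_lt_card_iff_nontrivial.1 (by omega)
  ext a b
  refine ⟨fun h ↦ h.ne, fun hab ↦ ?_⟩
  obtain ⟨c, hc⟩ := (G.degree_pos_iff_exists_adj a).1
    (hG.connected.preconnected.degree_pos_of_nontrivial a)
  have huniv : ({a, b} : Finset V) = Finset.univ :=
    Finset.eq_univ_of_card _ (by rw [Finset.card_pair hab, hV])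
  have hcab : c ∈ ({a, b} : Finset V) := huniv ▸ Finset.mem_univ c
  simp only [Finset.mem_insert, Finset.mem_singleton] at hcab
  obtain rfl | rfl := hcab
  · exact absurd rfl hc.ne
  · exact hc

lemma eq_of_adj_of_degree_eq_one {G : SimpleGraph V} {v w x : V} (hd : G.degree v = 1)
    (hw : G.Adj v w) (hx : G.Adj v x) : x = w :=
  (G.degree_eq_one_iff_existsUnique_adj.1 hd).unique hx hw

/-- Removing a leaf `v` attached to `w` lowers the degree of `w` by one and keeps all others. -/
lemma degree_induce_compl_leaf {G : SimpleGraph V} {v : V} (hd : G.degree v = 1)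
    (w : ({v}ᶜ : Set V)) (hw : G.Adj v w) (x : ({v}ᶜ : Set V)) :
    (G.induce {v}ᶜ).degree x = if x = w then G.degree x - 1 else G.degree x := by
  have hmap : ((G.induce {v}ᶜ).neighborFinset x).map (Function.Embedding.subtype _) =
      (G.neighborFinset x).erase v := by
    ext y
    simp
    tauto
  rw [← card_neighborFinset_eq_degree, ← Finset.card_map, hmap]
  split_ifs with h
  · subst h
    rw [Finset.card_erase_of_mem (by simpa using hw.symm), card_neighborFinset_eq_degree]
  · rw [Finset.erase_eq_of_notMem, card_neighborFinset_eq_degree]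
    intro hv
    exact h (Subtype.ext (eq_of_adj_of_degree_eq_one hd hw (((G.mem_neighborFinset x v).1 hv).symm)))

/-- The degree sequence left after removing a leaf `v` attached to `w`. -/
noncomputable def leafRemovedDegrees (d : V → ℕ) (v : V) (w : ({v}ᶜ : Set V)) :
    ({v}ᶜ : Set V) → ℕ :=
  fun x ↦ if x = w then d x - 1 else d x

lemma card_treesWithDegrees_adj_le (d : V → ℕ) {v : V} (hv : d v = 1) (w : ({v}ᶜ : Set V)) :
    ((treesWithDegrees V d).filter fun G ↦ G.Adj v w).card ≤
      (treesWithDegrees ({v}ᶜ : Set V) (leafRemovedDegrees d v w)).card := by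
  refine Finset.card_le_card_of_injOn (fun G ↦ G.induce {v}ᶜ) ?_ ?_
  · intro G hG
    simp only [Finset.coe_filter, Set.mem_ofPred_eq, mem_treesWithDegrees] at hG
    obtain ⟨⟨hT, hdeg⟩, hadj⟩ := hG
    have hone : G.degree v = 1 := (hdeg v).trans hv
    refine mem_treesWithDegrees.2
      ⟨⟨hT.connected.induce_compl_singleton_of_degree_eq_one hone, hT.isAcyclic.induce _⟩, ?_⟩
    intro x
    rw [leafRemovedDegrees, ← hdeg]
    convert degree_induce_compl_leaf hone w hadj x
  · intro G hG H hH hGH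
    simp only [Finset.coe_filter, Set.mem_ofPred_eq, mem_treesWithDegrees] at hG hH
    have hvG (x : V) : G.Adj v x ↔ H.Adj v x := by
      constructor
      · intro h
        rw [eq_of_adj_of_degree_eq_one ((hG.1.2 v).trans hv) hG.2 h]
        exact hH.2
      · intro h
        rw [eq_of_adj_of_degree_eq_one ((hH.1.2 v).trans hv) hH.2 h]
        exact hG.2
    ext a b
    by_cases ha : a = v
    · subst ha
      exact hvG b
    by_cases hb : b = v
    · subst hb
      rw [G.adj_comm, H.adj_comm]
      exact hvG a
    · have := congrArg (fun K : SimpleGraph ({v}ᶜ : Set V) ↦ K.Adj ⟨a, ha⟩ ⟨b, hb⟩) hGH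
      simpa using this

lemma card_treesWithDegrees_le_sum (d : V → ℕ) {v : V} (hv : d v = 1) :
    (treesWithDegrees V d).card ≤
      ∑ w, (treesWithDegrees ({v}ᶜ : Set V) (leafRemovedDegrees d v w)).card := by
  calc
    _ ≤ (Finset.univ.biUnion fun w : ({v}ᶜ : Set V) ↦
          (treesWithDegrees V d).filter fun G ↦ G.Adj v w).card := by
        refine Finset.card_le_card fun G hG ↦ ?_
        obtain ⟨w, hw⟩ := (G.degree_pos_iff_exists_adj v).1
          (by rw [(mem_treesWithDegrees.1 hG).2 v, hv]; exact one_pos)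
        simp only [Finset.mem_biUnion, Finset.mem_univ, true_and, Finset.mem_filter]
        exact ⟨⟨w, hw.ne'⟩, hG, hw⟩
    _ ≤ ∑ w : ({v}ᶜ : Set V), ((treesWithDegrees V d).filter fun G ↦ G.Adj v w).card :=
        Finset.card_biUnion_le
    _ ≤ _ := Finset.sum_le_sum fun w _ ↦ card_treesWithDegrees_adj_le d hv w

lemma card_treesWithDegrees_eq_zero [Nontrivial V] {d : V → ℕ} {v : V} (hv : d v = 0) :
    (treesWithDegrees V d).card = 0 := by
  refine Finset.card_eq_zero.2 (Finset.eq_empty_of_forall_notMem fun G hG ↦ ?_)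
  obtain ⟨hT, hdeg⟩ := mem_treesWithDegrees.1 hG
  have := hT.connected.preconnected.degree_pos_of_nontrivial v
  have := hdeg v
  omega

/-- Upper bound half of the formula `(m - 2)! / ∏ (d v - 1)!` for the number of labeled trees with
degree sequence `d`. -/
theorem card_treesWithDegrees_mul_prod_le (n : ℕ) (hV : Fintype.card V = n + 2) (d : V → ℕ) :
    (treesWithDegrees V d).card * ∏ v, (d v - 1).factorial ≤ n.factorial := by
  induction n generalizing V with
  | zero =>
    obtain hS | ⟨G, hG⟩ := (treesWithDegrees V d).eq_empty_or_nonempty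
    · simp [hS]
    have hcard : (treesWithDegrees V d).card ≤ 1 := by
      refine Finset.card_le_one.2 fun G hG H hH ↦ ?_
      rw [(mem_treesWithDegrees.1 hG).1.eq_top_of_card_eq_two hV,
        (mem_treesWithDegrees.1 hH).1.eq_top_of_card_eq_two hV]
    have hprod : ∏ v, (d v - 1).factorial = 1 := by
      refine Finset.prod_eq_one fun v _ ↦ Nat.factorial_eq_one.2 ?_
      have h1 := G.degree_lt_card_verts v
      have h2 := (mem_treesWithDegrees.1 hG).2 v
      omega
    simpa [hprod] using hcard
  | succ n ih =>
    obtain hS | ⟨G, hG⟩ := (treesWithDegrees V d).eq_empty_or_nonempty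
    · simp [hS]
    have : Nontrivial V := Fintype.one_lt_card_iff_nontrivial.1 (by omega)
    obtain ⟨hT, hdeg⟩ := mem_treesWithDegrees.1 hG
    obtain ⟨v, hGv⟩ := hT.exists_vert_degree_one_of_nontrivial
    have hv : d v = 1 := (hdeg v).symm.trans hGv
    have hW : Fintype.card ({v}ᶜ : Set V) = n + 2 := by
      rw [Fintype.card_compl_set]
      simp [hV]
    have : Nontrivial ({v}ᶜ : Set V) := Fintype.one_lt_card_iff_nontrivial.1 (by omega)
    have hsplit (f : V → ℕ) : (∏ x, f x = f v * ∏ x : ({v}ᶜ : Set V), f x) ∧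
        (∑ x, f x = f v + ∑ x : ({v}ᶜ : Set V), f x) :=
      ⟨Fintype.prod_eq_mul_prod_subtype_ne f v, Fintype.sum_eq_add_sum_subtype_ne f v⟩
    have hsum : ∑ w : ({v}ᶜ : Set V), (d w - 1) = n + 1 := by
      have h1 : ∑ x, (d x - 1) + ∑ _x : V, 1 = ∑ x, G.degree x := by
        rw [← Finset.sum_add_distrib]
        refine Finset.sum_congr rfl fun x _ ↦ ?_
        have := hT.connected.preconnected.degree_pos_of_nontrivial x
        have := hdeg x
        omega
      have h2 := hT.sum_degree_add_two
      have h3 := (hsplit fun x ↦ d x - 1).2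
      simp only [Finset.sum_const, Finset.card_univ, smul_eq_mul, mul_one] at h1
      omega
    have hstep (w : ({v}ᶜ : Set V)) :
        (treesWithDegrees ({v}ᶜ : Set V) (leafRemovedDegrees d v w)).card *
          ∏ x : ({v}ᶜ : Set V), (d x - 1).factorial ≤ (d w - 1) * n.factorial := by
      obtain hw | hw := Nat.lt_or_ge (d w) 2
      · rw [card_treesWithDegrees_eq_zero (v := w) (by simp [leafRemovedDegrees]; omega)]
        simp
      have hprod : ∏ x : ({v}ᶜ : Set V), (d x - 1).factorial =
          (d w - 1) * ∏ x, (leafRemovedDegrees d v w x - 1).factorial := by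
        rw [← Finset.mul_prod_erase _ _ (Finset.mem_univ w),
          ← Finset.mul_prod_erase _ (fun x ↦ (leafRemovedDegrees d v w x - 1).factorial)
            (Finset.mem_univ w), ← mul_assoc]
        congr 1
        · simp only [leafRemovedDegrees, if_true]
          exact (Nat.mul_factorial_pred (by omega)).symm
        · refine Finset.prod_congr rfl fun x hx ↦ ?_
          simp [leafRemovedDegrees, Finset.ne_of_mem_erase hx]
      rw [hprod, mul_left_comm]
      exact Nat.mul_le_mul_left _ (ih hW _)
    calc
      _ = (treesWithDegrees V d).card * ∏ x : ({v}ᶜ : Set V), (d x - 1).factorial := by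
          rw [(hsplit fun x ↦ (d x - 1).factorial).1]
          simp [hv]
      _ ≤ ∑ w, (treesWithDegrees ({v}ᶜ : Set V) (leafRemovedDegrees d v w)).card *
            ∏ x : ({v}ᶜ : Set V), (d x - 1).factorial := by
          rw [← Finset.sum_mul]
          exact Nat.mul_le_mul_right _ (card_treesWithDegrees_le_sum d hv)
      _ ≤ ∑ w : ({v}ᶜ : Set V), (d w - 1) * n.factorial := Finset.sum_le_sum fun w _ ↦ hstep w
      _ = (n + 1).factorial := by rw [← Finset.sum_mul, hsum, Nat.factorial_succ]

lemma card_treesWithDegrees_mul_prod_factorial_le {n : ℕ} (hV : Fintype.card V = n + 2)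
    (d : V → ℕ) :
    ((treesWithDegrees V d).card * ∏ v, (d v).factorial : ℚ) ≤
      n.factorial * 4 ^ (n + 1) * ∏ v, (d v / 2 ^ d v : ℚ) := by
  have : Nontrivial V := Fintype.one_lt_card_iff_nontrivial.1 (by omega)
  obtain hS | ⟨G, hG⟩ := (treesWithDegrees V d).eq_empty_or_nonempty
  · simp only [hS, Finset.card_empty, Nat.cast_zero, zero_mul]
    positivity
  obtain ⟨hT, hdeg⟩ := mem_treesWithDegrees.1 hG
  have hsum : ∑ v, d v = 2 * (n + 1) := by
    have := hT.sum_degree_add_two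
    simp only [hdeg] at this
    omega
  have hfac : ∏ v, (d v).factorial = (∏ v, (d v - 1).factorial) * ∏ v, d v := by
    rw [← Finset.prod_mul_distrib]
    refine Finset.prod_congr rfl fun v _ ↦ ?_
    have := hT.connected.preconnected.degree_pos_of_nontrivial v
    rw [mul_comm, Nat.mul_factorial_pred (by rw [← hdeg v]; omega)]
  have hle : (treesWithDegrees V d).card * ∏ v, (d v).factorial ≤ n.factorial * ∏ v, d v := by
    rw [hfac, ← mul_assoc]
    exact Nat.mul_le_mul_right _ (card_treesWithDegrees_mul_prod_le n hV d)
  have hpow : (∏ v, (2 : ℚ) ^ d v) = 4 ^ (n + 1) := by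
    rw [Finset.prod_pow_eq_pow_sum, hsum, pow_mul]
    norm_num
  rw [Finset.prod_div_distrib, hpow, mul_assoc, mul_div_cancel₀ _ (by positivity)]
  exact_mod_cast hle

lemma sum_range_div_two_pow_le (n : ℕ) : ∑ k ∈ Finset.range n, (k / 2 ^ k : ℚ) ≤ 2 := by
  have h : ∑ k ∈ Finset.range n, (k / 2 ^ k : ℚ) = 2 - 2 * (n + 1) / 2 ^ n := by
    induction n with
    | zero => norm_num
    | succ n ih =>
      rw [Finset.sum_range_succ, ih]
      push_cast
      field_simp
      ring
  rw [h]
  exact sub_le_self _ (by positivity)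

theorem sum_isTree_prod_factorial_degree_le {n : ℕ} (hV : Fintype.card V = n + 2) :
    ∑ G : SimpleGraph V with G.IsTree, ∏ v, (G.degree v).factorial ≤
      n.factorial * 8 ^ (n + 2) := by
  have hmaps : ∀ G ∈ (Finset.univ.filter fun G : SimpleGraph V ↦ G.IsTree),
      (fun v ↦ G.degree v) ∈ Fintype.piFinset fun _ : V ↦ Finset.range (n + 2) := by
    intro G _
    simp only [Fintype.mem_piFinset, Finset.mem_range, ← hV]
    exact fun v ↦ G.degree_lt_card_verts v
  have hfiber (d : V → ℕ) :
      ∑ G ∈ (Finset.univ.filter fun G : SimpleGraph V ↦ G.IsTree) with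
          (fun v ↦ G.degree v) = d, ∏ v, (G.degree v).factorial =
        (treesWithDegrees V d).card * ∏ v, (d v).factorial := by
    rw [Finset.filter_filter, ← smul_eq_mul]
    simp only [funext_iff]
    refine Finset.sum_eq_card_nsmul fun G hG ↦ ?_
    simp only [(mem_treesWithDegrees.1 hG).2]
  rw [← Finset.sum_fiberwise_of_maps_to hmaps]
  simp only [hfiber]
  suffices h : ((∑ d ∈ Fintype.piFinset fun _ : V ↦ Finset.range (n + 2),
      (treesWithDegrees V d).card * ∏ v, (d v).factorial : ℕ) : ℚ) ≤
        (n.factorial * 8 ^ (n + 2) : ℕ) by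
    exact_mod_cast h
  push_cast
  simp only [← Nat.cast_prod]
  calc
    _ ≤ ∑ d ∈ Fintype.piFinset fun _ : V ↦ Finset.range (n + 2),
          (n.factorial * 4 ^ (n + 1) * ∏ v, (d v / 2 ^ d v : ℚ)) :=
        Finset.sum_le_sum fun d _ ↦ card_treesWithDegrees_mul_prod_factorial_le hV d
    _ = n.factorial * 4 ^ (n + 1) *
          (∑ k ∈ Finset.range (n + 2), (k / 2 ^ k : ℚ)) ^ (n + 2) := by
        rw [← Finset.mul_sum,
          ← Finset.prod_univ_sum (fun _ : V ↦ Finset.range (n + 2)) fun _ k ↦ (k / 2 ^ k : ℚ),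
          Finset.prod_const, Finset.card_univ, hV]
    _ ≤ n.factorial * 4 ^ (n + 1) * 2 ^ (n + 2) := by
        gcongr
        exact sum_range_div_two_pow_le _
    _ ≤ n.factorial * 4 ^ (n + 2) * 2 ^ (n + 2) := by
        gcongr <;> norm_num
    _ = n.factorial * 8 ^ (n + 2) := by
        rw [mul_assoc, ← mul_pow]
        norm_num

end SimpleGraph

/-- **Tree sum bound.** For every `m ≥ 1`, the sum over all labeled trees `T` on `{1,…,m}`
of the product over the vertices of the factorial of their degree is at most `m!·8^m`. -/
theorem stmt_16 (m : ℕ) (hm : 1 ≤ m) :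
    ∑ G : SimpleGraph (Fin m),
        (if G.IsTree then ∏ l, ((G.neighborSet l).ncard).factorial else 0)
      ≤ m.factorial * 8 ^ m := by
  have hdeg (G : SimpleGraph (Fin m)) (l : Fin m) : (G.neighborSet l).ncard = G.degree l := by
    rw [← G.card_neighborSet_eq_degree, ← Nat.card_eq_fintype_card, Nat.card_coe_set_eq]
  simp only [hdeg]
  rw [← Finset.sum_filter]
  obtain rfl | ⟨n, rfl⟩ : m = 1 ∨ ∃ n, m = n + 2 := by
    obtain h | h := hm.eq_or_lt
    · exact Or.inl h.symm
    · exact Or.inr ⟨m - 2, by omega⟩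
  · calc
      _ ≤ ∑ G : SimpleGraph (Fin 1) with G.IsTree, 1 := by
          refine Finset.sum_le_sum fun G _ ↦ (Finset.prod_eq_one fun l _ ↦ ?_).le
          have := G.degree_lt_card_verts l
          rw [Fintype.card_fin] at this
          exact Nat.factorial_eq_one.2 this.le
      _ ≤ 1 := by
          rw [← Finset.card_eq_sum_ones]
          exact Finset.card_le_one_of_subsingleton _
      _ ≤ _ := by norm_num
  · have h := SimpleGraph.sum_isTree_prod_factorial_degree_le (Fintype.card_fin (n + 2))
    refine le_trans (le_of_eq ?_)
      (h.trans (Nat.mul_le_mul_right _ (Nat.factorial_le (Nat.le_add_right n 2))))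
    congr!
end
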